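/- Let v₁ = (−,+,+,−), v₂ = (+,+,−,+), v₃ = (+,−,−,−), v₄ = (−,−,−,−) in V. The eight hypermatrices v₁ + s₂•v₂ + s₃•v₃ + s₄•v₄, for (s₂,s₃,s₄) ranging over {1,−1}³, lie in pairwise distinct G-orbits: no two of them are carried to one another by an element of G. -/

import Mathlib

/-- The space of real 2×2×2×2 hypermatrices. -/
abbrev V : Type := Fin 2 → Fin 2 → Fin 2 → Fin 2 → ℝ

/-- The group `SL₂(ℝ)⁴`. -/
abbrev G : Type :=
  Matrix.SpecialLinearGroup (Fin 2) ℝ × Matrix.SpecialLinearGroup (Fin 2) ℝ ×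
    Matrix.SpecialLinearGroup (Fin 2) ℝ × Matrix.SpecialLinearGroup (Fin 2) ℝ

/-- The natural linear action of `G = SL₂(ℝ)⁴` on `V`. -/
noncomputable def actG (g : G) (T : V) : V := fun i₁ i₂ i₃ i₄ =>
  ∑ j₁ : Fin 2, ∑ j₂ : Fin 2, ∑ j₃ : Fin 2, ∑ j₄ : Fin 2,
    (g.1 : Matrix (Fin 2) (Fin 2) ℝ) i₁ j₁ * (g.2.1 : Matrix (Fin 2) (Fin 2) ℝ) i₂ j₂ *
      (g.2.2.1 : Matrix (Fin 2) (Fin 2) ℝ) i₃ j₃ * (g.2.2.2 : Matrix (Fin 2) (Fin 2) ℝ) i₄ j₄ *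
      T j₁ j₂ j₃ j₄

/-- The basis hypermatrix with a single `1` at position `(a,b,c,d)`; the sign `+` corresponds to
index `0` and the sign `−` to index `1`. -/
def bv (a b c d : Fin 2) : V := fun i₁ i₂ i₃ i₄ =>
  if i₁ = a ∧ i₂ = b ∧ i₃ = c ∧ i₄ = d then 1 else 0

/-- `v₁ = (−,+,+,−)` -/ noncomputable def v₁ : V := bv 1 0 0 1
/-- `v₂ = (+,+,−,+)` -/ noncomputable def v₂ : V := bv 0 0 1 0
/-- `v₃ = (+,−,−,−)` -/ noncomputable def v₃ : V := bv 0 1 1 1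
/-- `v₄ = (−,−,−,−)` -/ noncomputable def v₄ : V := bv 1 1 1 1

open Matrix

/-- The matrix in the first and fourth indices obtained by contracting the second and third indices
of `T` with `Y` and `Z`. -/
def contract₂₃ (T : V) (Y Z : Fin 2 → ℝ) : Matrix (Fin 2) (Fin 2) ℝ :=
  fun i l => ∑ j, ∑ k, T i j k l * Y j * Z k

/-- The matrix in the first and third indices obtained by contracting the second and fourth indices
of `T` with `Y` and `W`. -/
def contract₂₄ (T : V) (Y W : Fin 2 → ℝ) : Matrix (Fin 2) (Fin 2) ℝ :=
  fun i k => ∑ j, ∑ l, T i j k l * Y j * W l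

lemma contract₂₃_actG (g : G) (T : V) (Y Z : Fin 2 → ℝ) :
    contract₂₃ (actG g T) Y Z =
      g.1.1 * contract₂₃ T (g.2.1.1ᵀ *ᵥ Y) (g.2.2.1.1ᵀ *ᵥ Z) * g.2.2.2.1ᵀ := by
  ext i l
  simp only [contract₂₃, actG, Matrix.mul_apply, Matrix.mulVec, dotProduct, Matrix.transpose_apply,
    Fin.sum_univ_two]
  ring

lemma contract₂₄_actG (g : G) (T : V) (Y W : Fin 2 → ℝ) :
    contract₂₄ (actG g T) Y W =
      g.1.1 * contract₂₄ T (g.2.1.1ᵀ *ᵥ Y) (g.2.2.2.1ᵀ *ᵥ W) * g.2.2.1.1ᵀ := by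
  ext i k
  simp only [contract₂₄, actG, Matrix.mul_apply, Matrix.mulVec, dotProduct, Matrix.transpose_apply,
    Fin.sum_univ_two]
  ring

lemma det_contract₂₃_actG (g : G) (T : V) (Y Z : Fin 2 → ℝ) :
    (contract₂₃ (actG g T) Y Z).det =
      (contract₂₃ T (g.2.1.1ᵀ *ᵥ Y) (g.2.2.1.1ᵀ *ᵥ Z)).det := by
  rw [contract₂₃_actG, Matrix.det_mul, Matrix.det_mul, Matrix.det_transpose, g.1.2, g.2.2.2.2,
    one_mul, mul_one]

lemma det_contract₂₄_actG (g : G) (T : V) (Y W : Fin 2 → ℝ) :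
    (contract₂₄ (actG g T) Y W).det =
      (contract₂₄ T (g.2.1.1ᵀ *ᵥ Y) (g.2.2.2.1ᵀ *ᵥ W)).det := by
  rw [contract₂₄_actG, Matrix.det_mul, Matrix.det_mul, Matrix.det_transpose, g.1.2, g.2.2.1.2,
    one_mul, mul_one]

/-- The biquadratic form `p Y₀² Z₀ Z₁ + q Y₀ Y₁ Z₁²`. -/
def biquadratic (p q : ℝ) (Y Z : Fin 2 → ℝ) : ℝ :=
  Y 0 * Z 1 * (p * (Y 0 * Z 0) + q * (Y 1 * Z 1))

lemma det_contract₂₃_representative (a b c : ℝ) (Y Z : Fin 2 → ℝ) :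
    (contract₂₃ (v₁ + a • v₂ + b • v₃ + c • v₄) Y Z).det = biquadratic a (a * c) Y Z := by
  simp [contract₂₃, biquadratic, Matrix.det_fin_two, Fin.sum_univ_two, v₁, v₂, v₃, v₄, bv]
  ring

lemma det_contract₂₄_representative (a b c : ℝ) (Y W : Fin 2 → ℝ) :
    (contract₂₄ (v₁ + a • v₂ + b • v₃ + c • v₄) Y W).det = biquadratic (-a) (-b) Y W := by
  simp [contract₂₄, biquadratic, Matrix.det_fin_two, Fin.sum_univ_two, v₁, v₂, v₃, v₄, bv]
  ring

/-- A unimodular substitution carrying one biquadratic form to another is triangular in both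
variables, hence multiplies the coefficients by squares. -/
lemma biquadratic_coeff_eq_sq_mul {p q p' q' : ℝ} (hp : p ≠ 0) (hq : q ≠ 0)
    {A B : Matrix (Fin 2) (Fin 2) ℝ} (hA : A.det = 1) (hB : B.det = 1)
    (h : ∀ Y Z, biquadratic p' q' Y Z = biquadratic p q (A *ᵥ Y) (B *ᵥ Z)) :
    p' = A 0 0 ^ 2 * p ∧ q' = B 1 1 ^ 2 * q := by
  rw [Matrix.det_fin_two] at hA hB
  have hA01 : A 0 1 = 0 := by
    have h₁ := h ![0, 1] ![-B 0 1, B 0 0]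
    have h₂ := h ![0, 1] ![B 1 1 - B 0 1, B 0 0 - B 1 0]
    simp only [biquadratic, mulVec, dotProduct, Fin.sum_univ_two, cons_val_zero,
      cons_val_one] at h₁ h₂
    have hB₁ : B 1 0 * -B 0 1 + B 1 1 * B 0 0 = 1 := by linarith
    have hB₂ : B 0 0 * -B 0 1 + B 0 1 * B 0 0 = 0 := by ring
    have hB₃ : B 1 0 * (B 1 1 - B 0 1) + B 1 1 * (B 0 0 - B 1 0) = 1 := by linarith
    have hB₄ : B 0 0 * (B 1 1 - B 0 1) + B 0 1 * (B 0 0 - B 1 0) = 1 := by linarith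
    rw [hB₁, hB₂] at h₁
    rw [hB₃, hB₄] at h₂
    have : p * A 0 1 ^ 2 = 0 := by linarith
    simpa [hp] using this
  have hB10 : B 1 0 = 0 := by
    have h₁ := h ![A 1 1, -A 1 0] ![1, 0]
    have h₂ := h ![A 1 1 - A 0 1, A 0 0 - A 1 0] ![1, 0]
    simp only [biquadratic, mulVec, dotProduct, Fin.sum_univ_two, cons_val_zero,
      cons_val_one] at h₁ h₂
    have hA₁ : A 0 0 * A 1 1 + A 0 1 * -A 1 0 = 1 := by linarith
    have hA₂ : A 1 0 * A 1 1 + A 1 1 * -A 1 0 = 0 := by ring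
    have hA₃ : A 0 0 * (A 1 1 - A 0 1) + A 0 1 * (A 0 0 - A 1 0) = 1 := by linarith
    have hA₄ : A 1 0 * (A 1 1 - A 0 1) + A 1 1 * (A 0 0 - A 1 0) = 1 := by linarith
    rw [hA₁, hA₂] at h₁
    rw [hA₃, hA₄] at h₂
    have : q * B 1 0 ^ 2 = 0 := by linarith
    simpa [hq] using this
  have h₀ := h ![1, 0] ![0, 1]
  have h₁ := h ![1, 0] ![1, 1]
  have h₂ := h ![1, 1] ![0, 1]
  simp only [biquadratic, mulVec, dotProduct, Fin.sum_univ_two, cons_val_zero, cons_val_one,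
    hA01, hB10] at h₀ h₁ h₂
  rw [hA01] at hA
  rw [hB10] at hB
  constructor
  · linear_combination h₁ - h₀ + A 0 0 ^ 2 * p * hB
  · linear_combination h₂ - h₀ + B 1 1 ^ 2 * q * hA

/-- The eight hypermatrices `v₁ + s₂•v₂ + s₃•v₃ + s₄•v₄` for `(s₂,s₃,s₄) ∈ {1,−1}³` lie in
pairwise distinct `G`-orbits. -/
theorem eight_representatives_pairwise_distinct_orbits :
    ∀ s₂ s₃ s₄ t₂ t₃ t₄ : ℝ,
      (s₂ = 1 ∨ s₂ = -1) → (s₃ = 1 ∨ s₃ = -1) → (s₄ = 1 ∨ s₄ = -1) →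
      (t₂ = 1 ∨ t₂ = -1) → (t₃ = 1 ∨ t₃ = -1) → (t₄ = 1 ∨ t₄ = -1) →
      (s₂, s₃, s₄) ≠ (t₂, t₃, t₄) →
      ∀ g : G, actG g (v₁ + s₂ • v₂ + s₃ • v₃ + s₄ • v₄) ≠ v₁ + t₂ • v₂ + t₃ • v₃ + t₄ • v₄ := by
  intro s₂ s₃ s₄ t₂ t₃ t₄ hs₂ hs₃ hs₄ ht₂ ht₃ ht₄ hne g hg
  have unit_ne_zero {x : ℝ} (hx : x = 1 ∨ x = -1) : x ≠ 0 := by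
    rcases hx with rfl | rfl <;> norm_num
  have unit_eq {x y r : ℝ} (hx : x = 1 ∨ x = -1) (hy : y = 1 ∨ y = -1) (h : y = r ^ 2 * x) :
      x = y := by
    rcases hx with rfl | rfl <;> rcases hy with rfl | rfl <;>
      first | rfl | nlinarith [sq_nonneg r]
  have det_transpose_eq (u : Matrix.SpecialLinearGroup (Fin 2) ℝ) : u.1ᵀ.det = 1 := by
    rw [Matrix.det_transpose, u.2]
  obtain ⟨h₂, h₂₄⟩ := biquadratic_coeff_eq_sq_mul (p' := t₂) (q' := t₂ * t₄)
    (unit_ne_zero hs₂) (mul_ne_zero (unit_ne_zero hs₂) (unit_ne_zero hs₄))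
    (det_transpose_eq g.2.1) (det_transpose_eq g.2.2.1) fun Y Z => by
      rw [← det_contract₂₃_representative t₂ t₃ t₄, ← hg, det_contract₂₃_actG,
        det_contract₂₃_representative]
  obtain ⟨-, h₃⟩ := biquadratic_coeff_eq_sq_mul (p' := -t₂) (q' := -t₃)
    (neg_ne_zero.mpr (unit_ne_zero hs₂)) (neg_ne_zero.mpr (unit_ne_zero hs₃))
    (det_transpose_eq g.2.1) (det_transpose_eq g.2.2.2) fun Y W => by
      rw [← det_contract₂₄_representative t₂ t₃ t₄, ← hg, det_contract₂₄_actG,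
        det_contract₂₄_representative]
  have e₂ : s₂ = t₂ := unit_eq hs₂ ht₂ h₂
  have e₃ : s₃ = t₃ := unit_eq hs₃ ht₃ (neg_injective (by rw [h₃, mul_neg]))
  have e₄ : s₄ = t₄ := by
    subst e₂
    exact unit_eq hs₄ ht₄ (mul_left_cancel₀ (unit_ne_zero hs₂) (by rw [h₂₄]; ring))
  exact hne (by rw [e₂, e₃, e₄])
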